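/- Let M ⊆ E be a closed connected invariant set of descending flow of J and let D ⊆ M be an invariant set of descending flow which is open in M. If C_M(D) ≠ M, inf_{u ∈ ∂_M D} J(u) > −∞, and J satisfies the (PS) condition on M∖D, then c = inf_{u ∈ ∂_M C_M(D)} J(u) ≥ inf_{u ∈ ∂_M D} J(u) > −∞, c is a critical value of J, and there exists a critical point u* ∈ ∂_M C_M(D) with J'(u*) = 0 and J(u*) = c. (Theorem 1.2) -/

import Mathlib

open Filter Topology Set

noncomputable section

variable {E : Type*} [NormedAddCommGroup E] [NormedSpace ℝ E]

/-- boundary of `S` relative to the subspace topology of `M` (for `S ⊆ M`). -/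
def relBoundary (M S : Set E) : Set E :=
  M ∩ closure S ∩ closure (M \ S)

/-- `C_M(D)`: points of `M` whose descending-flow orbit enters `D`. -/
def flowCM (J : E → ℝ) (σ : E → ℝ → E) (T : E → ENNReal) (M D : Set E) : Set E :=
  {u ∈ M | u ∈ D ∨ (fderiv ℝ J u ≠ 0 ∧
    ∃ t : ℝ, 0 ≤ t ∧ ENNReal.ofReal t < T u ∧ σ u t ∈ D)}

/-- `σ` is the right-maximal flow of the vector field `V` on the set `U`; the solution starting
at `u ∈ U` lives on `[0, T u)`. -/
structure IsMaximalFlow (U : Set E) (V : E → E) (σ : E → ℝ → E) (T : E → ENNReal) : Prop where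
  isOpen : IsOpen U
  lipschitz : ∀ u ∈ U, ∃ K : NNReal, ∃ t ∈ 𝓝 u, LipschitzOnWith K V t
  zero : ∀ u, σ u 0 = u
  hasDerivAt : ∀ u ∈ U, ∀ t : ℝ, 0 ≤ t → ENNReal.ofReal t < T u →
    σ u t ∈ U ∧ HasDerivAt (σ u) (V (σ u t)) t
  maximal : ∀ u ∈ U, ∀ (T' : ℝ) (τ : ℝ → E), τ 0 = u →
    (∀ t ∈ Ico (0 : ℝ) T', τ t ∈ U ∧ HasDerivAt τ (V (τ t)) t) →
    ENNReal.ofReal T' ≤ T u ∧ ∀ t ∈ Ico (0 : ℝ) T', τ t = σ u t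

/-- `S` is positively invariant under the flow `σ` on `U`. -/
def FlowInvariant (U : Set E) (σ : E → ℝ → E) (T : E → ENNReal) (S : Set E) : Prop :=
  ∀ u ∈ S, u ∈ U → ∀ t : ℝ, 0 ≤ t → ENNReal.ofReal t < T u → σ u t ∈ S

lemma ENNReal.exists_ofReal_btwn {t : ℝ} {a : ENNReal} (h : ENNReal.ofReal t < a) :
    ∃ t', t < t' ∧ ENNReal.ofReal t' < a := by
  obtain ⟨b, -, h1, h2⟩ := ENNReal.lt_iff_exists_real_btwn.1 h
  exact ⟨b, (ENNReal.ofReal_lt_ofReal_iff'.1 h1).1, h2⟩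

lemma ENNReal.ofReal_lt_of_le {s t : ℝ} {a : ENNReal} (hst : s ≤ t)
    (h : ENNReal.ofReal t < a) : ENNReal.ofReal s < a :=
  (ENNReal.ofReal_le_ofReal hst).trans_lt h

/-- Local flow of a locally Lipschitz autonomous vector field, staying in a given neighbourhood. -/
lemma exists_local_flow [CompleteSpace E] {V : E → E} {x : E} {K : NNReal} {s : Set E}
    (hs : s ∈ 𝓝 x) (hV : LipschitzOnWith K V s) {U : Set E} (hU : U ∈ 𝓝 x) :
    ∃ ε > (0 : ℝ), ∃ α : E → ℝ → E,
      (∀ᶠ v in 𝓝 x, α v 0 = v ∧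
        ∀ t ∈ Ico 0 ε, α v t ∈ U ∧ HasDerivAt (α v) (V (α v t)) t) ∧
      ∀ t ∈ Ico 0 ε, ContinuousAt (α · t) x := by
  obtain ⟨a, ha, has⟩ := Metric.nhds_basis_closedBall.mem_iff.1 hs
  set a' : NNReal := ⟨a, ha.le⟩
  set L : NNReal := ‖V x‖₊ + K * a' + 1 with hL
  have hLpos : (0 : ℝ) < L := by rw [hL]; push_cast; positivity
  set ε : ℝ := a / 2 / L with hε
  have hεpos : 0 < ε := by positivity
  have hpl : IsPicardLindelof (fun _ ↦ V) (tmin := -ε) (tmax := ε) ⟨0, by simp [hεpos.le]⟩ x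
      a' (a' / 2) L K := by
    refine IsPicardLindelof.of_time_independent (fun y hy ↦ ?_) (hV.mono has) ?_
    · have h1 := hV.dist_le_mul y (has hy) x (mem_of_mem_nhds hs)
      rw [dist_eq_norm] at h1
      have h2 : (K : ℝ) * dist y x ≤ K * a := by gcongr; exact hy
      have h3 := norm_le_norm_add_norm_sub' (V y) (V x)
      have h4 : (L : ℝ) = ‖V x‖ + K * a + 1 := by rw [hL]; push_cast; rfl
      rw [h4]; linarith
    · simp only [sub_zero, zero_sub, neg_neg, max_self]
      have : (L : ℝ) * ε = a / 2 := by rw [hε]; field_simp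
      rw [this]; push_cast
      change a / 2 ≤ a - a / 2
      linarith
  obtain ⟨α, hα, hcont⟩ := hpl.exists_forall_mem_closedBall_eq_hasDerivWithinAt_continuousOn
  have hr : Metric.closedBall x ((a' / 2 : NNReal) : ℝ) ∈ 𝓝 x := by
    apply Metric.closedBall_mem_nhds
    push_cast
    exact half_pos ha
  have h0 : ContinuousAt α (x, 0) :=
    hcont.continuousAt (prod_mem_nhds hr (Icc_mem_nhds (by linarith) hεpos))
  have hαx : α (x, 0) = x := (hα x (mem_of_mem_nhds hr)).1
  have hmem : ∀ᶠ p in 𝓝 x ×ˢ 𝓝 (0 : ℝ), α p ∈ U := by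
    rw [← nhds_prod_eq]
    exact h0.eventually_mem (by rwa [hαx])
  obtain ⟨p, hp, q, hq, hpq⟩ := eventually_prod_iff.1 hmem
  obtain ⟨ρ, hρ, hρq⟩ := Metric.eventually_nhds_iff.1 hq
  refine ⟨min ε ρ, lt_min hεpos hρ, fun v t ↦ α (v, t), ?_, fun t ht ↦ ?_⟩
  · filter_upwards [hp, hr] with v hv hvr
    refine ⟨(hα v hvr).1, fun t ht ↦ ⟨hpq hv (hρq ?_), ?_⟩⟩
    · rw [Real.dist_eq, sub_zero, abs_of_nonneg ht.1]
      exact ht.2.trans_le (min_le_right _ _)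
    · have : t < ε := ht.2.trans_le (min_le_left _ _)
      have h5 : -ε < t := by linarith [ht.1]
      exact ((hα v hvr).2 t ⟨h5.le, this.le⟩).hasDerivAt (Icc_mem_nhds h5 this)
  · have : t < ε := ht.2.trans_le (min_le_left _ _)
    have h5 : -ε < t := by linarith [ht.1]
    exact (hcont.continuousAt (prod_mem_nhds hr (Icc_mem_nhds h5 this))).comp
      (f := fun v ↦ (v, t)) (by fun_prop)

namespace IsMaximalFlow

variable {U : Set E} {V : E → E} {σ : E → ℝ → E} {T : E → ENNReal}

lemma exists_local [CompleteSpace E] (h : IsMaximalFlow U V σ T) {x : E} (hx : x ∈ U) :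
    ∃ ε > (0 : ℝ), (∀ᶠ v in 𝓝 x, v ∈ U ∧ ENNReal.ofReal ε ≤ T v) ∧
      ∀ t ∈ Ico 0 ε, ContinuousAt (σ · t) x := by
  obtain ⟨K, s, hs, hK⟩ := h.lipschitz x hx
  obtain ⟨ε, hε, α, hα, hc⟩ := exists_local_flow hs hK (h.isOpen.mem_nhds hx)
  have key : ∀ᶠ v in 𝓝 x, v ∈ U ∧ ENNReal.ofReal ε ≤ T v ∧ ∀ t ∈ Ico 0 ε, α v t = σ v t := by
    filter_upwards [hα, h.isOpen.mem_nhds hx] with v hv hvU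
    exact ⟨hvU, h.maximal v hvU ε (α v) hv.1 hv.2⟩
  refine ⟨ε, hε, key.mono fun v hv ↦ ⟨hv.1, hv.2.1⟩, fun t ht ↦ ?_⟩
  exact (hc t ht).congr (key.mono fun v hv ↦ hv.2.2 t ht)

lemma add_lt (h : IsMaximalFlow U V σ T) {u : E} (hu : u ∈ U) {s r : ℝ} (hs : 0 ≤ s)
    (hsT : ENNReal.ofReal s < T u) (hr : 0 ≤ r) (hrT : ENNReal.ofReal r < T (σ u s)) :
    ENNReal.ofReal (s + r) < T u ∧ σ (σ u s) r = σ u (s + r) := by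
  obtain ⟨r', hrr', hr'⟩ := ENNReal.exists_ofReal_btwn hrT
  have hv := (h.hasDerivAt u hu s hs hsT).1
  set v := σ u s
  set τ : ℝ → E := fun t ↦ if t ≤ s then σ u t else σ v (t - s) with hτ
  have hτ1 : ∀ t ≤ s, τ t = σ u t := fun t ht ↦ if_pos ht
  have hτ2 : ∀ t, s ≤ t → τ t = σ v (t - s) := by
    intro t ht
    rcases ht.eq_or_lt with rfl | ht
    · rw [hτ1 _ le_rfl, sub_self, h.zero]
    · exact if_neg ht.not_ge
  have hR : ∀ t, s ≤ t → t < s + r' → σ v (t - s) ∈ U ∧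
      HasDerivAt (fun y ↦ σ v (y - s)) (V (σ v (t - s))) t := by
    intro t ht ht'
    have := h.hasDerivAt v hv (t - s) (by linarith)
      (ENNReal.ofReal_lt_of_le (by linarith) hr')
    exact ⟨this.1, this.2.comp_sub_const t s⟩
  have hmain := h.maximal u hu (s + r') τ (by rw [hτ1 0 hs, h.zero]) <| by
    intro t ht
    rcases lt_trichotomy t s with hts | rfl | hts
    · obtain ⟨h1, h2⟩ := h.hasDerivAt u hu t ht.1 (ENNReal.ofReal_lt_of_le hts.le hsT)
      rw [hτ1 t hts.le]
      refine ⟨h1, h2.congr_of_eventuallyEq ?_⟩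
      filter_upwards [Iio_mem_nhds hts] with y hy using hτ1 y (le_of_lt hy)
    · obtain ⟨h1, h2⟩ := h.hasDerivAt u hu t hs hsT
      obtain ⟨h3, h4⟩ := hR t le_rfl ht.2
      rw [sub_self, h.zero] at h4
      rw [hτ1 t le_rfl]
      refine ⟨h1, ?_⟩
      rw [← hasDerivWithinAt_univ, ← Iic_union_Ici (a := t)]
      refine HasDerivWithinAt.union ?_ ?_
      · exact h2.hasDerivWithinAt.congr (fun y hy ↦ hτ1 y hy) (hτ1 t le_rfl)
      · exact h4.hasDerivWithinAt.congr (fun y hy ↦ hτ2 y hy) (hτ2 t le_rfl)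
    · obtain ⟨h1, h2⟩ := hR t hts.le ht.2
      rw [hτ2 t hts.le]
      refine ⟨h1, h2.congr_of_eventuallyEq ?_⟩
      filter_upwards [Ioi_mem_nhds hts] with y hy using hτ2 y (le_of_lt hy)
  refine ⟨lt_of_lt_of_le ?_ hmain.1, ?_⟩
  · exact (ENNReal.ofReal_lt_ofReal_iff (by linarith)).2 (by linarith)
  · rw [← hmain.2 (s + r) ⟨by linarith, by linarith⟩, hτ2 _ (by linarith), add_sub_cancel_left]

lemma lt_of_add_lt (h : IsMaximalFlow U V σ T) {u : E} (hu : u ∈ U) {s r : ℝ} (hs : 0 ≤ s)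
    (hr : 0 ≤ r) (hT : ENNReal.ofReal (s + r) < T u) : ENNReal.ofReal r < T (σ u s) := by
  obtain ⟨r', hrr', hr'⟩ := ENNReal.exists_ofReal_btwn hT
  have hv := (h.hasDerivAt u hu s hs (ENNReal.ofReal_lt_of_le (by linarith) hT)).1
  have hmain := h.maximal (σ u s) hv (r' - s) (fun t ↦ σ u (s + t)) (by simp) <| by
    intro t ht
    obtain ⟨h1, h2⟩ := h.hasDerivAt u hu (s + t) (by linarith [ht.1])
      (ENNReal.ofReal_lt_of_le (by linarith [ht.2]) hr')
    exact ⟨h1, h2.comp_const_add s t⟩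
  exact lt_of_lt_of_le ((ENNReal.ofReal_lt_ofReal_iff (by linarith)).2 (by linarith)) hmain.1

lemma continuousOn (h : IsMaximalFlow U V σ T) {u : E} (hu : u ∈ U) {s t : ℝ} (hs : 0 ≤ s)
    (hT : ENNReal.ofReal t < T u) : ContinuousOn (σ u) (Icc s t) := fun y hy ↦
  (h.hasDerivAt u hu y (hs.trans hy.1)
    (ENNReal.ofReal_lt_of_le hy.2 hT)).2.continuousAt.continuousWithinAt

end IsMaximalFlow

/-- The relative boundary of a relatively open set is its relative closure minus the set. -/
lemma relBoundary_eq {E : Type*} [NormedAddCommGroup E] {M S : Set E} (hS : ∀ u ∈ S, S ∈ 𝓝[M] u) :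
    relBoundary M S = closure S ∩ (M \ S) := by
  ext u
  refine ⟨fun hu ↦ ⟨hu.1.2, hu.1.1, fun huS ↦ ?_⟩,
    fun hu ↦ ⟨⟨hu.2.1, hu.1⟩, subset_closure hu.2⟩⟩
  obtain ⟨v, hv, hvS⟩ := ((mem_closure_iff_frequently.1 hu.2).and_eventually
    (eventually_nhdsWithin_iff.1 (hS u huS))).exists
  exact hv.2 (hvS hv.1)

lemma relBoundary_nonempty {E : Type*} [NormedAddCommGroup E] {M S : Set E}
    (hM : IsPreconnected M) (hSM : S ⊆ M)
    (hS : S.Nonempty) (hne : S ≠ M) : (relBoundary M S).Nonempty := by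
  obtain ⟨x, hx⟩ := hS
  obtain ⟨y, hyM, hyS⟩ := exists_of_ssubset (hSM.ssubset_of_ne hne)
  obtain ⟨z, h1, h2, h3⟩ := isPreconnected_closed_iff.1 hM (closure S) (closure (M \ S))
    isClosed_closure isClosed_closure
    (fun v hv ↦ (em (v ∈ S)).imp (fun hh ↦ subset_closure hh) fun hh ↦ subset_closure ⟨hv, hh⟩)
    ⟨x, hSM hx, subset_closure hx⟩ ⟨y, hyM, subset_closure ⟨hyM, hyS⟩⟩
  exact ⟨z, ⟨h1, h2⟩, h3⟩

/-! ### The set of points flowing into `D` -/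

section FlowCM

variable {J : E → ℝ} {V : E → E} {σ : E → ℝ → E} {T : E → ENNReal} {M D : Set E}

lemma flowCM_subset : flowCM J σ T M D ⊆ M := fun _ hu ↦ hu.1

lemma subset_flowCM (hDM : D ⊆ M) : D ⊆ flowCM J σ T M D := fun _ hu ↦ ⟨hDM hu, Or.inl hu⟩

lemma mem_flowCM_of_flow_mem (h : IsMaximalFlow {u | fderiv ℝ J u ≠ 0} V σ T) {u : E}
    (huM : u ∈ M) (hu : fderiv ℝ J u ≠ 0) {t : ℝ} (ht : 0 ≤ t) (htT : ENNReal.ofReal t < T u)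
    (hC : σ u t ∈ flowCM J σ T M D) : u ∈ flowCM J σ T M D := by
  refine ⟨huM, Or.inr ⟨hu, ?_⟩⟩
  rcases hC.2 with hD | ⟨-, r, hr, hrT, hD⟩
  · exact ⟨t, ht, htT, hD⟩
  · obtain ⟨h1, h2⟩ := h.add_lt hu ht htT hr hrT
    exact ⟨t + r, by linarith, h1, h2 ▸ hD⟩

lemma flowInvariant_flowCM (h : IsMaximalFlow {u | fderiv ℝ J u ≠ 0} V σ T)
    (hM : FlowInvariant {u | fderiv ℝ J u ≠ 0} σ T M)
    (hD : FlowInvariant {u | fderiv ℝ J u ≠ 0} σ T D) :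
    FlowInvariant {u | fderiv ℝ J u ≠ 0} σ T (flowCM J σ T M D) := by
  intro u hu huU t ht htT
  refine ⟨hM u hu.1 huU t ht htT, ?_⟩
  rcases hu.2 with huD | ⟨-, r, hr, hrT, hrD⟩
  · exact Or.inl (hD u huD huU t ht htT)
  rcases le_total t r with htr | htr
  · have h1 : ENNReal.ofReal (r - t) < T (σ u t) :=
      h.lt_of_add_lt huU ht (by linarith) (by rwa [add_sub_cancel])
    refine Or.inr ⟨(h.hasDerivAt u huU t ht htT).1, r - t, by linarith, h1, ?_⟩
    rw [(h.add_lt huU ht htT (by linarith) h1).2, add_sub_cancel]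
    exact hrD
  · left
    have h1 : ENNReal.ofReal (t - r) < T (σ u r) :=
      h.lt_of_add_lt huU hr (by linarith) (by rwa [add_sub_cancel])
    have h2 := hD _ hrD (h.hasDerivAt u huU r hr hrT).1 (t - r) (by linarith) h1
    rwa [(h.add_lt huU hr hrT (by linarith) h1).2, add_sub_cancel] at h2

lemma flowCM_mem_nhdsWithin [CompleteSpace E]
    (h : IsMaximalFlow {u | fderiv ℝ J u ≠ 0} V σ T)
    (hM : FlowInvariant {u | fderiv ℝ J u ≠ 0} σ T M)
    (hDM : D ⊆ M) (hDopen : ∀ u ∈ D, D ∈ 𝓝[M] u) {u : E} (hu : u ∈ flowCM J σ T M D) :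
    flowCM J σ T M D ∈ 𝓝[M] u := by
  set C := flowCM J σ T M D
  rcases hu.2 with huD | ⟨huU, t, ht, htT, htD⟩
  · exact mem_of_superset (hDopen u huD) (subset_flowCM hDM)
  have step : ∀ x ∈ M, fderiv ℝ J x ≠ 0 → ∃ ε > (0 : ℝ), ∀ r ∈ Ico 0 ε,
      C ∈ 𝓝[M] (σ x r) → C ∈ 𝓝[M] x := by
    intro x _ hxU
    obtain ⟨ε, hε, hev, hc⟩ := h.exists_local hxU
    refine ⟨ε, hε, fun r hr hC ↦ ?_⟩
    have hlt : ENNReal.ofReal r < ENNReal.ofReal ε := (ENNReal.ofReal_lt_ofReal_iff hε).2 hr.2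
    have htend : Tendsto (σ · r) (𝓝[M] x) (𝓝[M] (σ x r)) := by
      refine tendsto_nhdsWithin_iff.2 ⟨(hc r hr).tendsto.mono_left nhdsWithin_le_nhds, ?_⟩
      filter_upwards [nhdsWithin_le_nhds hev, self_mem_nhdsWithin] with v hv hvM
      exact hM v hvM hv.1 r hr.1 (hlt.trans_le hv.2)
    filter_upwards [htend hC, nhdsWithin_le_nhds hev, self_mem_nhdsWithin] with v h1 h2 h3
    exact mem_flowCM_of_flow_mem h h3 h2.1 hr.1 (hlt.trans_le h2.2) h1
  have hlt : ∀ s ≤ t, ENNReal.ofReal s < T u := fun s hs ↦ ENNReal.ofReal_lt_of_le hs htT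
  set A : Set ℝ := {s ∈ Icc 0 t | C ∈ 𝓝[M] (σ u s)}
  have htA : t ∈ A := ⟨⟨ht, le_rfl⟩, mem_of_superset (hDopen _ htD) (subset_flowCM hDM)⟩
  have hAbdd : BddBelow A := ⟨0, fun s hs ↦ hs.1.1⟩
  have hs0 : 0 ≤ sInf A := le_csInf ⟨t, htA⟩ fun s hs ↦ hs.1.1
  have hst : sInf A ≤ t := csInf_le hAbdd htA
  obtain ⟨ε, hε, hstep⟩ := step (σ u (sInf A)) (hM u hu.1 huU _ hs0 (hlt _ hst))
    (h.hasDerivAt u huU _ hs0 (hlt _ hst)).1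
  obtain ⟨s, hsA, hs⟩ := exists_lt_of_csInf_lt ⟨t, htA⟩ (lt_add_of_pos_right (sInf A) hε)
  have hle : sInf A ≤ s := csInf_le hAbdd hsA
  have hinf : C ∈ 𝓝[M] (σ u (sInf A)) := by
    refine hstep (s - sInf A) ⟨by linarith, by linarith⟩ ?_
    have h1 : ENNReal.ofReal (s - sInf A) < T (σ u (sInf A)) :=
      h.lt_of_add_lt huU hs0 (by linarith) (by rw [add_sub_cancel]; exact hlt s hsA.1.2)
    rw [(h.add_lt huU hs0 (hlt _ hst) (by linarith) h1).2, add_sub_cancel]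
    exact hsA.2
  rcases hs0.eq_or_lt with h0 | hpos
  · rwa [← h0, h.zero] at hinf
  have hev : ∀ᶠ y in 𝓝 (σ u (sInf A)), y ∈ M → C ∈ 𝓝[M] y :=
    eventually_nhdsWithin_iff.1 (eventually_eventually_nhdsWithin.2 hinf)
  have hcont := (h.hasDerivAt u huU _ hs0 (hlt _ hst)).2.continuousAt
  obtain ⟨y, hy, hy'⟩ := (((hcont.eventually hev).filter_mono nhdsWithin_le_nhds).and
    (Ioo_mem_nhdsLT hpos)).exists
  have hyt : y ≤ t := hy'.2.le.trans hst
  have hyM := hM u hu.1 huU y hy'.1.le (hlt y hyt)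
  have hyA : y ∈ A := ⟨⟨hy'.1.le, hyt⟩, hy hyM⟩
  exact absurd (csInf_le hAbdd hyA) hy'.2.not_ge

lemma flowInvariant_closure [CompleteSpace E] {U S : Set E} (h : IsMaximalFlow U V σ T)
    (hS : FlowInvariant U σ T S) : FlowInvariant U σ T (closure S) := by
  intro u hu huU t ht htT
  have hlt : ∀ s ≤ t, ENNReal.ofReal s < T u := fun s hs ↦ ENNReal.ofReal_lt_of_le hs htT
  have hclosed : IsClosed (σ u ⁻¹' closure S ∩ Icc 0 t) := by
    rw [inter_comm]
    exact (h.continuousOn huU le_rfl htT).preimage_isClosed_of_isClosed isClosed_Icc isClosed_closure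
  refine hclosed.Icc_subset_of_forall_exists_gt (by simpa [h.zero] using hu) ?_ ⟨ht, le_rfl⟩
  intro s ⟨hsS, hs⟩ y hy
  have hsU := (h.hasDerivAt u huU s hs.1 (hlt s hs.2.le)).1
  obtain ⟨ε, hε, hev, hc⟩ := h.exists_local hsU
  set r := min (ε / 2) (min (y - s) (t - s))
  have hr0 : 0 < r := by
    have := hs.2; have : s < y := hy
    refine lt_min (by linarith) (lt_min ?_ ?_) <;> linarith
  have hrε : r < ε := (min_le_left _ _).trans_lt (by linarith)
  have hry : r ≤ y - s := (min_le_right _ _).trans (min_le_left _ _)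
  have hrt : r ≤ t - s := (min_le_right _ _).trans (min_le_right _ _)
  refine ⟨s + r, ?_, by simpa using hr0, by linarith⟩
  have hlt' : ENNReal.ofReal r < ENNReal.ofReal ε := (ENNReal.ofReal_lt_ofReal_iff hε).2 hrε
  have hfreq : ∃ᶠ v in 𝓝 (σ u s), σ v r ∈ S := by
    refine ((mem_closure_iff_frequently.1 hsS).and_eventually hev).mono ?_
    exact fun v hv ↦ hS v hv.1 hv.2.1 r hr0.le (hlt'.trans_le hv.2.2)
  have h1 : σ (σ u s) r ∈ closure S :=
    mem_closure_of_frequently_of_tendsto hfreq (hc r ⟨hr0.le, hrε⟩)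
  rwa [(h.add_lt huU hs.1 (hlt s hs.2.le) hr0.le (hlt'.trans_le hev.self_of_nhds.2)).2] at h1

lemma flowInvariant_relBoundary_flowCM [CompleteSpace E]
    (h : IsMaximalFlow {u | fderiv ℝ J u ≠ 0} V σ T)
    (hM : FlowInvariant {u | fderiv ℝ J u ≠ 0} σ T M)
    (hD : FlowInvariant {u | fderiv ℝ J u ≠ 0} σ T D)
    (hDM : D ⊆ M) (hDopen : ∀ u ∈ D, D ∈ 𝓝[M] u) :
    FlowInvariant {u | fderiv ℝ J u ≠ 0} σ T (relBoundary M (flowCM J σ T M D)) := by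
  rw [relBoundary_eq fun u ↦ flowCM_mem_nhdsWithin h hM hDM hDopen]
  intro u hu huU t ht htT
  exact ⟨flowInvariant_closure h (flowInvariant_flowCM h hM hD) u hu.1 huU t ht htT,
    hM u hu.2.1 huU t ht htT,
    fun hC ↦ hu.2.2 (mem_flowCM_of_flow_mem h hu.2.1 huU ht htT hC)⟩

end FlowCM

/-! ### Descent along the flow -/

section Descent

variable {J : E → ℝ} {W : E → E} {σ : E → ℝ → E} {T : E → ENNReal}

lemma hasDerivAt_comp_flow (hJ : Differentiable ℝ J)
    (h : IsMaximalFlow {u | fderiv ℝ J u ≠ 0} (fun u ↦ -W u) σ T)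
    {u : E} (hu : fderiv ℝ J u ≠ 0) {t : ℝ} (ht : 0 ≤ t) (htT : ENNReal.ofReal t < T u) :
    HasDerivAt (fun t ↦ J (σ u t)) (-(fderiv ℝ J (σ u t) (W (σ u t)))) t := by
  have := (hJ (σ u t)).hasFDerivAt.comp_hasDerivAt t (h.hasDerivAt u hu t ht htT).2
  rwa [map_neg] at this

/-- Along an orbit on which the gradient stays above `δ`, the value of `J` drops at least at
rate `δ ^ 2`. -/
lemma flow_add_mul_le (hJ : Differentiable ℝ J)
    (h : IsMaximalFlow {u | fderiv ℝ J u ≠ 0} (fun u ↦ -W u) σ T)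
    (hW2 : ∀ u : E, fderiv ℝ J u ≠ 0 → ‖fderiv ℝ J u‖ ^ 2 ≤ fderiv ℝ J u (W u))
    {u : E} (hu : fderiv ℝ J u ≠ 0) {δ : ℝ} (hδ : 0 ≤ δ) {s t : ℝ} (hs : 0 ≤ s) (hst : s ≤ t)
    (htT : ENNReal.ofReal t < T u)
    (hle : ∀ y ∈ Icc s t, δ ≤ ‖fderiv ℝ J (σ u y)‖) :
    J (σ u t) + δ ^ 2 * (t - s) ≤ J (σ u s) := by
  have hd : ∀ y ∈ Icc s t, HasDerivAt (fun t ↦ J (σ u t) + δ ^ 2 * (t - s))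
      (-(fderiv ℝ J (σ u y) (W (σ u y))) + δ ^ 2) y := by
    intro y hy
    refine (hasDerivAt_comp_flow hJ h hu (hs.trans hy.1)
      (ENNReal.ofReal_lt_of_le hy.2 htT)).add ?_
    simpa using ((hasDerivAt_id y).sub_const s).const_mul (δ ^ 2)
  have hanti := antitoneOn_of_hasDerivWithinAt_nonpos (convex_Icc s t)
    (fun y hy ↦ (hd y hy).continuousAt.continuousWithinAt)
    (fun y hy ↦ (hd y (interior_subset hy)).hasDerivWithinAt) <| by
      intro y hy
      have hy := interior_subset hy
      have h1 := hW2 _ (h.hasDerivAt u hu y (hs.trans hy.1)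
        (ENNReal.ofReal_lt_of_le hy.2 htT)).1
      have h2 := pow_le_pow_left₀ hδ (hle y hy) 2
      linarith
  simpa using hanti (left_mem_Icc.2 hst) (right_mem_Icc.2 hst) hst

lemma flow_le (hJ : Differentiable ℝ J)
    (h : IsMaximalFlow {u | fderiv ℝ J u ≠ 0} (fun u ↦ -W u) σ T)
    (hW2 : ∀ u : E, fderiv ℝ J u ≠ 0 → ‖fderiv ℝ J u‖ ^ 2 ≤ fderiv ℝ J u (W u))
    {u : E} (hu : fderiv ℝ J u ≠ 0) {s t : ℝ} (hs : 0 ≤ s) (hst : s ≤ t)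
    (htT : ENNReal.ofReal t < T u) : J (σ u t) ≤ J (σ u s) := by
  simpa using flow_add_mul_le hJ h hW2 hu le_rfl hs hst htT fun y _ ↦ norm_nonneg _

/-- Along an orbit on which the gradient stays above `δ`, the length is controlled by the drop
of `J`. -/
lemma norm_flow_sub_le (hJ : Differentiable ℝ J)
    (h : IsMaximalFlow {u | fderiv ℝ J u ≠ 0} (fun u ↦ -W u) σ T)
    (hW1 : ∀ u : E, fderiv ℝ J u ≠ 0 → ‖W u‖ ≤ 2 * ‖fderiv ℝ J u‖)
    (hW2 : ∀ u : E, fderiv ℝ J u ≠ 0 → ‖fderiv ℝ J u‖ ^ 2 ≤ fderiv ℝ J u (W u))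
    {u : E} (hu : fderiv ℝ J u ≠ 0) {δ : ℝ} (hδ : 0 < δ) {s t : ℝ} (hs : 0 ≤ s) (hst : s ≤ t)
    (htT : ENNReal.ofReal t < T u)
    (hle : ∀ y ∈ Icc s t, δ ≤ ‖fderiv ℝ J (σ u y)‖) :
    ‖σ u t - σ u s‖ ≤ 2 / δ * (J (σ u s) - J (σ u t)) := by
  have hlt : ∀ y ∈ Icc s t, ENNReal.ofReal y < T u := fun y hy ↦
    ENNReal.ofReal_lt_of_le hy.2 htT
  have hd : ∀ y ∈ Icc s t, HasDerivAt (fun t ↦ 2 / δ * (J (σ u s) - J (σ u t)))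
      (2 / δ * fderiv ℝ J (σ u y) (W (σ u y))) y := by
    intro y hy
    simpa using ((hasDerivAt_comp_flow hJ h hu (hs.trans hy.1) (hlt y hy)).const_sub
      (J (σ u s))).const_mul (2 / δ)
  refine image_norm_le_of_norm_deriv_right_le_deriv_boundary'
    (f := fun y ↦ σ u y - σ u s) (f' := fun y ↦ -W (σ u y))
    ((h.continuousOn hu hs htT).sub continuousOn_const)
    (fun y hy ↦ ((h.hasDerivAt u hu y (hs.trans hy.1)
      (hlt y (Ico_subset_Icc_self hy))).2.sub_const _).hasDerivWithinAt)
    (by simp) (fun y hy ↦ (hd y hy).continuousAt.continuousWithinAt)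
    (fun y hy ↦ (hd y (Ico_subset_Icc_self hy)).hasDerivWithinAt) ?_ ⟨hst, le_rfl⟩
  intro y hy
  have hy := Ico_subset_Icc_self hy
  have hU := (h.hasDerivAt u hu y (hs.trans hy.1) (hlt y hy)).1
  have h1 := hW1 _ hU
  have h2 := hW2 _ hU
  have h3 := hle y hy
  rw [norm_neg, div_mul_eq_mul_div, le_div_iff₀ hδ]
  nlinarith [norm_nonneg (fderiv ℝ J (σ u y))]

/-- An orbit in a closed set on which `J` is bounded below meets points of small gradient. -/
lemma exists_flow_norm_fderiv_lt [CompleteSpace E] (hJ : ContDiff ℝ 1 J)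
    (h : IsMaximalFlow {u | fderiv ℝ J u ≠ 0} (fun u ↦ -W u) σ T)
    (hW1 : ∀ u : E, fderiv ℝ J u ≠ 0 → ‖W u‖ ≤ 2 * ‖fderiv ℝ J u‖)
    (hW2 : ∀ u : E, fderiv ℝ J u ≠ 0 → ‖fderiv ℝ J u‖ ^ 2 ≤ fderiv ℝ J u (W u))
    {B : Set E} (hB : FlowInvariant {u | fderiv ℝ J u ≠ 0} σ T B)
    {c : ℝ} (hc : ∀ u ∈ B, c ≤ J u) {u : E} (huB : u ∈ B) (hu : fderiv ℝ J u ≠ 0)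
    {δ : ℝ} (hδ : 0 < δ) :
    ∃ t : ℝ, 0 ≤ t ∧ ENNReal.ofReal t < T u ∧ ‖fderiv ℝ J (σ u t)‖ < δ := by
  by_contra! hcon
  have hd : Differentiable ℝ J := hJ.differentiable one_ne_zero
  have hTpos : 0 < T u := by
    obtain ⟨ε, hε, hev, -⟩ := h.exists_local hu
    exact (ENNReal.ofReal_pos.2 hε).trans_le hev.self_of_nhds.2
  have hdrop : ∀ t : ℝ, 0 ≤ t → ENNReal.ofReal t < T u → δ ^ 2 * t ≤ J u - c := by
    intro t ht htT
    have h1 := flow_add_mul_le hd h hW2 hu hδ.le le_rfl ht htT fun y hy ↦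
      hcon y hy.1 (ENNReal.ofReal_lt_of_le hy.2 htT)
    have h2 := hc _ (hB u huB hu t ht htT)
    rw [h.zero, sub_zero] at h1
    linarith
  have hTfin : T u ≠ ⊤ := by
    intro htop
    have hc0 := hc u huB
    have hx : 0 ≤ (J u - c) / δ ^ 2 + 1 := by
      have : 0 ≤ J u - c := by linarith
      positivity
    have h1 := hdrop ((J u - c) / δ ^ 2 + 1) hx (by simp [htop])
    have h2 : δ ^ 2 * ((J u - c) / δ ^ 2 + 1) = J u - c + δ ^ 2 := by field_simp
    nlinarith [pow_pos hδ 2]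
  set t₀ := (T u).toReal
  have ht₀pos : 0 < t₀ := ENNReal.toReal_pos hTpos.ne' hTfin
  have hlt : ∀ {t : ℝ}, 0 ≤ t → (ENNReal.ofReal t < T u ↔ t < t₀) := fun ht ↦
    ENNReal.ofReal_lt_iff_lt_toReal ht hTfin
  set G := (fun t ↦ J (σ u t)) '' Ico 0 t₀
  have hGbdd : BddBelow G := by
    refine ⟨c, ?_⟩
    rintro _ ⟨t, ht, rfl⟩
    exact hc _ (hB u huB hu t ht.1 ((hlt ht.1).2 ht.2))
  have hcauchy : Cauchy (map (σ u) (𝓝[<] t₀)) := by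
    refine Metric.cauchy_iff.2 ⟨inferInstance, fun η hη ↦ ?_⟩
    obtain ⟨_, ⟨s, hs, rfl⟩, hsG⟩ := exists_lt_of_csInf_lt (s := G)
      ⟨_, 0, ⟨le_rfl, ht₀pos⟩, rfl⟩ (lt_add_of_pos_right (sInf G) (by positivity : 0 < δ * η / 4))
    refine ⟨σ u '' Ico s t₀, image_mem_map (Ico_mem_nhdsLT hs.2), ?_⟩
    have key : ∀ t ∈ Ico s t₀, dist (σ u t) (σ u s) < η / 2 := by
      intro t ht
      have ht0 := hs.1.trans ht.1
      have h1 := norm_flow_sub_le hd h hW1 hW2 hu hδ hs.1 ht.1 ((hlt ht0).2 ht.2) fun y hy ↦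
        hcon y (hs.1.trans hy.1) ((hlt (hs.1.trans hy.1)).2 (hy.2.trans_lt ht.2))
      have h2 : sInf G ≤ J (σ u t) := csInf_le hGbdd ⟨t, ⟨ht0, ht.2⟩, rfl⟩
      rw [dist_eq_norm]
      refine h1.trans_lt ?_
      rw [div_mul_eq_mul_div, div_lt_iff₀ hδ]
      simp only at hsG
      linarith
    rintro _ ⟨t, ht, rfl⟩ _ ⟨t', ht', rfl⟩
    have h1 := key t ht
    have h2 := key t' ht'
    have h3 := dist_triangle_right (σ u t) (σ u t') (σ u s)
    linarith
  obtain ⟨x, hx⟩ := CompleteSpace.complete hcauchy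
  have hx : Tendsto (σ u) (𝓝[<] t₀) (𝓝 x) := hx
  have hIco : ∀ᶠ t in 𝓝[<] t₀, t ∈ Ico 0 t₀ := Ico_mem_nhdsLT ht₀pos
  have hxδ : δ ≤ ‖fderiv ℝ J x‖ := by
    refine ge_of_tendsto (((hJ.continuous_fderiv one_ne_zero).norm.tendsto x).comp hx) ?_
    exact hIco.mono fun t ht ↦ hcon t ht.1 ((hlt ht.1).2 ht.2)
  obtain ⟨ε, hε, hev, -⟩ := h.exists_local (x := x) (norm_pos_iff.1 (hδ.trans_le hxδ))
  have hnear : ∀ᶠ t in 𝓝[<] t₀, t ∈ Ioo (t₀ - ε) t₀ := Ioo_mem_nhdsLT (by linarith)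
  obtain ⟨t, ht, ht', htε⟩ := (hIco.and (hnear.and (hx.eventually hev))).exists
  have h1 := (h.add_lt hu ht.1 ((hlt ht.1).2 ht.2) (r := t₀ - t) (by linarith [ht.2])
    (((ENNReal.ofReal_lt_ofReal_iff hε).2 (by linarith [ht'.1])).trans_le htε.2)).1
  rw [add_sub_cancel, hlt ht₀pos.le] at h1
  exact lt_irrefl _ h1

/-- Orbits starting in `C_M(D) \ D` enter `D` through the relative boundary of `D`. -/
lemma sInf_relBoundary_le (hJ : Differentiable ℝ J)
    (h : IsMaximalFlow {u | fderiv ℝ J u ≠ 0} (fun u ↦ -W u) σ T)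
    (hW2 : ∀ u : E, fderiv ℝ J u ≠ 0 → ‖fderiv ℝ J u‖ ^ 2 ≤ fderiv ℝ J u (W u))
    {M D : Set E} (hM : FlowInvariant {u | fderiv ℝ J u ≠ 0} σ T M)
    (hbdd : BddBelow (J '' relBoundary M D)) {u : E} (hu : u ∈ flowCM J σ T M D) (huD : u ∉ D) :
    sInf (J '' relBoundary M D) ≤ J u := by
  obtain ⟨huU, t, ht, htT, htD⟩ := hu.2.resolve_left huD
  set A : Set ℝ := {s ∈ Icc 0 t | σ u s ∈ D}
  have htA : t ∈ A := ⟨⟨ht, le_rfl⟩, htD⟩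
  have hAbdd : BddBelow A := ⟨0, fun s hs ↦ hs.1.1⟩
  set s := sInf A
  have hs0 : 0 ≤ s := le_csInf ⟨t, htA⟩ fun s hs ↦ hs.1.1
  have hst : s ≤ t := csInf_le hAbdd htA
  have hlt : ∀ y ≤ t, ENNReal.ofReal y < T u := fun y hy ↦ ENNReal.ofReal_lt_of_le hy htT
  have hcont := (h.hasDerivAt u huU s hs0 (hlt s hst)).2.continuousAt
  have hmem : σ u s ∈ relBoundary M D := by
    refine ⟨⟨hM u hu.1 huU s hs0 (hlt s hst), ?_⟩, ?_⟩
    · exact mem_closure_of_frequently_of_tendsto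
        ((mem_closure_iff_frequently.1 (csInf_mem_closure ⟨t, htA⟩ hAbdd)).mono fun y hy ↦ hy.2)
        hcont
    · rcases hs0.eq_or_lt with h0 | hpos
      · rw [← h0, h.zero]
        exact subset_closure ⟨hu.1, huD⟩
      · refine mem_closure_of_tendsto (hcont.tendsto.mono_left nhdsWithin_le_nhds)
          (b := 𝓝[<] s) ?_
        filter_upwards [Ioo_mem_nhdsLT hpos] with y hy
        have hyt : y ≤ t := hy.2.le.trans hst
        exact ⟨hM u hu.1 huU y hy.1.le (hlt y hyt),
          fun hyD ↦ (csInf_le hAbdd ⟨⟨hy.1.le, hyt⟩, hyD⟩).not_gt hy.2⟩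
  calc sInf (J '' relBoundary M D) ≤ J (σ u s) := csInf_le hbdd ⟨_, hmem, rfl⟩
    _ ≤ J (σ u 0) := flow_le hJ h hW2 huU le_rfl hs0 (hlt s hst)
    _ = J u := by rw [h.zero]

end Descent

/-- **Theorem 1.2.** Let `M` be a closed connected invariant set of the descending flow
of a `C¹` functional `J` and `D ⊆ M` an open invariant subset. If `C_M(D) ≠ M`,
`inf_{∂_M D} J > -∞` and `J` satisfies (PS) on `M \ D`, then
`c = inf_{∂_M C_M(D)} J ≥ inf_{∂_M D} J` and `c` is a critical value of `J`, attained at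
some critical point `u* ∈ ∂_M C_M(D)`. -/
theorem theorem_1_2
    {E : Type*} [NormedAddCommGroup E] [NormedSpace ℝ E] [CompleteSpace E]
    (J : E → ℝ) (hJ : ContDiff ℝ 1 J)
    (W : E → E)
    (hWlip : ∀ u : E, fderiv ℝ J u ≠ 0 →
      ∃ K' : NNReal, ∃ t ∈ 𝓝 u, LipschitzOnWith K' W t)
    (hW1 : ∀ u : E, fderiv ℝ J u ≠ 0 → ‖W u‖ ≤ 2 * ‖fderiv ℝ J u‖)
    (hW2 : ∀ u : E, fderiv ℝ J u ≠ 0 → ‖fderiv ℝ J u‖ ^ 2 ≤ fderiv ℝ J u (W u))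
    (σ : E → ℝ → E) (T : E → ENNReal)
    (hσ0 : ∀ u : E, σ u 0 = u)
    (hσderiv : ∀ u : E, fderiv ℝ J u ≠ 0 → ∀ t : ℝ, 0 ≤ t → ENNReal.ofReal t < T u →
      fderiv ℝ J (σ u t) ≠ 0 ∧ HasDerivAt (σ u) (-W (σ u t)) t)
    (hσmax : ∀ u : E, fderiv ℝ J u ≠ 0 → ∀ (T' : ℝ) (τ : ℝ → E), τ 0 = u →
      (∀ t ∈ Set.Ico (0 : ℝ) T', fderiv ℝ J (τ t) ≠ 0 ∧ HasDerivAt τ (-W (τ t)) t) →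
      ENNReal.ofReal T' ≤ T u ∧ ∀ t ∈ Set.Ico (0 : ℝ) T', τ t = σ u t)
    -- `M`: nonempty, closed, connected, invariant
    (M : Set E) (hMcl : IsClosed M) (hMconn : IsConnected M)
    (hMinv : ∀ u ∈ M, fderiv ℝ J u ≠ 0 → ∀ t : ℝ, 0 ≤ t →
      ENNReal.ofReal t < T u → σ u t ∈ M)
    -- `D ⊆ M`: nonempty, open in `M`, invariant
    (D : Set E) (hDne : D.Nonempty) (hDM : D ⊆ M)
    (hDopen : ∃ U : Set E, IsOpen U ∧ D = U ∩ M)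
    (hDinv : ∀ u ∈ D, fderiv ℝ J u ≠ 0 → ∀ t : ℝ, 0 ≤ t →
      ENNReal.ofReal t < T u → σ u t ∈ D)
    -- `C_M(D) ≠ M`
    (hne : flowCM J σ T M D ≠ M)
    -- `inf_{∂_M D} J > -∞`
    (hbdd : BddBelow (J '' relBoundary M D))
    -- (PS) condition on `M \ D`
    (hPS : ∀ u : ℕ → E, (∀ n, u n ∈ M \ D) → (∃ b : ℝ, ∀ n, |J (u n)| ≤ b) →
      Tendsto (fun n => ‖fderiv ℝ J (u n)‖) atTop (𝓝 0) →
      ∃ z : E, ∃ s : ℕ → ℕ, StrictMono s ∧ Tendsto (fun n => u (s n)) atTop (𝓝 z)) :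
    sInf (J '' relBoundary M D) ≤ sInf (J '' relBoundary M (flowCM J σ T M D)) ∧
    ∃ u' ∈ relBoundary M (flowCM J σ T M D),
      fderiv ℝ J u' = 0 ∧ J u' = sInf (J '' relBoundary M (flowCM J σ T M D)) := by
  set U : Set E := {u | fderiv ℝ J u ≠ 0}
  have hd : Differentiable ℝ J := hJ.differentiable one_ne_zero
  have hdc : Continuous (fderiv ℝ J) := hJ.continuous_fderiv one_ne_zero
  have h : IsMaximalFlow U (fun u ↦ -W u) σ T :=
    { isOpen := isOpen_ne_fun hdc continuous_const
      lipschitz := fun u hu ↦ by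
        obtain ⟨K, t, ht, hK⟩ := hWlip u hu
        exact ⟨K, t, ht, hK.neg⟩
      zero := hσ0
      hasDerivAt := hσderiv
      maximal := hσmax }
  have hDnhds : ∀ u ∈ D, D ∈ 𝓝[M] u := by
    obtain ⟨O, hO, rfl⟩ := hDopen
    exact fun u hu ↦ inter_mem (mem_nhdsWithin_of_mem_nhds (hO.mem_nhds hu.1)) self_mem_nhdsWithin
  set C := flowCM J σ T M D
  have hCnhds : ∀ u ∈ C, C ∈ 𝓝[M] u := fun u ↦ flowCM_mem_nhdsWithin h hMinv hDM hDnhds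
  have hDC : D ⊆ C := subset_flowCM hDM
  set B := relBoundary M C
  have hBclosed : IsClosed B := (hMcl.inter isClosed_closure).inter isClosed_closure
  have hBne : B.Nonempty :=
    relBoundary_nonempty hMconn.isPreconnected flowCM_subset (hDne.mono hDC) hne
  have hBeq : B = closure C ∩ (M \ C) := relBoundary_eq hCnhds
  have hBD : B ⊆ M \ D := by
    rw [hBeq]
    exact fun u hu ↦ ⟨hu.2.1, fun hD ↦ hu.2.2 (hDC hD)⟩
  have hBinv : FlowInvariant U σ T B :=
    flowInvariant_relBoundary_flowCM h hMinv hDinv hDM hDnhds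
  set m := sInf (J '' relBoundary M D)
  have hmB : ∀ u ∈ B, m ≤ J u := by
    intro u hu
    have hcl : u ∈ closure (C \ D ∪ D) := closure_mono (fun v hv ↦ by
      by_cases hvD : v ∈ D
      exacts [Or.inr hvD, Or.inl ⟨hv, hvD⟩]) hu.1.2
    rw [closure_union] at hcl
    rcases hcl with hcl | hcl
    · exact closure_minimal (t := {v | m ≤ J v})
        (fun v hv ↦ sInf_relBoundary_le hd h hW2 hMinv hbdd hv.1 hv.2)
        (isClosed_le continuous_const hJ.continuous) hcl
    · exact csInf_le hbdd ⟨u, ⟨⟨hu.1.1, hcl⟩, subset_closure (hBD hu)⟩, rfl⟩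
  have hmc : m ≤ sInf (J '' B) := le_csInf (hBne.image J) (by rintro _ ⟨u, hu, rfl⟩; exact hmB u hu)
  refine ⟨hmc, ?_⟩
  set c := sInf (J '' B)
  have hcB : ∀ u ∈ B, c ≤ J u := fun u hu ↦
    csInf_le ⟨m, by rintro _ ⟨v, hv, rfl⟩; exact hmB v hv⟩ ⟨u, hu, rfl⟩
  have happrox : ∀ δ > (0 : ℝ), ∃ v ∈ B, J v < c + δ ∧ ‖fderiv ℝ J v‖ < δ := by
    intro δ hδ
    obtain ⟨_, ⟨u, huB, rfl⟩, hu⟩ := exists_lt_of_csInf_lt (hBne.image J)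
      (lt_add_of_pos_right c hδ)
    by_cases huU : fderiv ℝ J u = 0
    · exact ⟨u, huB, hu, by simpa [huU] using hδ⟩
    obtain ⟨t, ht, htT, htδ⟩ := exists_flow_norm_fderiv_lt hJ h hW1 hW2 hBinv hcB huB huU hδ
    refine ⟨σ u t, hBinv u huB huU t ht htT, ?_, htδ⟩
    have := flow_le hd h hW2 huU le_rfl ht htT
    rw [hσ0] at this
    exact this.trans_lt hu
  choose v hvB hvJ hvd using fun n : ℕ ↦ happrox (1 / ((n : ℝ) + 1)) Nat.one_div_pos_of_nat
  have hlim : Tendsto (fun n : ℕ ↦ 1 / ((n : ℝ) + 1)) atTop (𝓝 0) :=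
    tendsto_one_div_add_atTop_nhds_zero_nat
  have hvd0 : Tendsto (fun n ↦ ‖fderiv ℝ J (v n)‖) atTop (𝓝 0) :=
    squeeze_zero (fun n ↦ norm_nonneg _) (fun n ↦ (hvd n).le) hlim
  have hvJc : Tendsto (fun n ↦ J (v n)) atTop (𝓝 c) :=
    tendsto_of_tendsto_of_tendsto_of_le_of_le tendsto_const_nhds
      (by simpa using hlim.const_add c) (fun n ↦ hcB _ (hvB n)) (fun n ↦ (hvJ n).le)
  have hvbdd : ∃ b : ℝ, ∀ n, |J (v n)| ≤ b := by
    obtain ⟨b, hb⟩ := hvJc.abs.bddAbove_range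
    exact ⟨b, fun n ↦ hb ⟨n, rfl⟩⟩
  obtain ⟨z, s, hs, hz⟩ := hPS v (fun n ↦ hBD (hvB n)) hvbdd hvd0
  refine ⟨z, hBclosed.mem_of_tendsto hz (Eventually.of_forall fun n ↦ hvB (s n)), ?_, ?_⟩
  · exact norm_eq_zero.1 (tendsto_nhds_unique ((hdc.norm.tendsto z).comp hz)
      (hvd0.comp hs.tendsto_atTop))
  · exact tendsto_nhds_unique ((hJ.continuous.tendsto z).comp hz) (hvJc.comp hs.tendsto_atTop)

end
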